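/- arXiv:2205.08385 — 5 statements merged into one kernel-verified Lean document; each statement's English description precedes it below -/
import Mathlib

section
/- Let n ≥ p be positive integers, let ℒ : ℝ^{n×p} → ℝ be differentiable with Euclidean gradient ∇ℒ, and let η, γ > 0. For any θ, φ ∈ ℝ^{n×p} with θᵀθ = I and Sym(θᵀφ) = 0, setting D = −γφ − ∇ℒ(θ), one has Sym(θᵀ(−θφᵀφ + (D − θ·Sym(θᵀD))/η)) = −φᵀφ; in other words, the vector field (θ,φ) ↦ (φ, −θφᵀφ + (D − θ·Sym(θᵀD))/η) is tangent to the tangent bundle of the Stiefel manifold at every point of the tangent bundle. -/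
open Matrix Set Filter

attribute [local instance] Matrix.normedAddCommGroup Matrix.normedSpace

noncomputable section

/-- `Sym(A) = (A + Aᵀ)/2`. -/
def symPart {p : ℕ} (A : Matrix (Fin p) (Fin p) ℝ) : Matrix (Fin p) (Fin p) ℝ :=
  (1 / 2 : ℝ) • (A + Aᵀ)

/-- Euclidean (Frobenius) inner product `⟨A, B⟩ = tr(AᵀB)`. -/
def mInner {m k : ℕ} (A B : Matrix (Fin m) (Fin k) ℝ) : ℝ := (Aᵀ * B).trace

/-- The norm induced from `mInner`. -/
def mNorm {m k : ℕ} (A : Matrix (Fin m) (Fin k) ℝ) : ℝ := Real.sqrt (mInner A A)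

/-- the vector field of system (4) is tangent to the tangent bundle
of the Stiefel manifold: for `(θ,φ)` with `θᵀθ = I` and `Sym(θᵀφ) = 0`, with
`D = -γφ - ∇ℒ(θ)`, one has `Sym(θᵀ(-θφᵀφ + (D - θ·Sym(θᵀD))/η)) = -φᵀφ`. -/
theorem stmt1 (n p : ℕ) (hp : 0 < p) (hpn : p ≤ n)
    (L : Matrix (Fin n) (Fin p) ℝ → ℝ)
    (G : Matrix (Fin n) (Fin p) ℝ → Matrix (Fin n) (Fin p) ℝ)
    (L' : Matrix (Fin n) (Fin p) ℝ → (Matrix (Fin n) (Fin p) ℝ →L[ℝ] ℝ))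
    (hLdiff : ∀ X, HasFDerivAt L (L' X) X)
    (hLgrad : ∀ X H, L' X H = mInner (G X) H)
    (η γ : ℝ) (hη : 0 < η) (hγ : 0 < γ)
    (θ φ : Matrix (Fin n) (Fin p) ℝ)
    (hθ : θᵀ * θ = 1) (hφ : symPart (θᵀ * φ) = 0) :
    symPart (θᵀ *
        (-(θ * φᵀ * φ) +
          η⁻¹ • ((-(γ • φ) - G θ) - θ * symPart (θᵀ * (-(γ • φ) - G θ))))) =
      -(φᵀ * φ) := by
  have _ := hLdiff
  generalize -(γ • φ) - G θ = D
  have h1 : θᵀ * (-(θ * φᵀ * φ) + η⁻¹ • (D - θ * symPart (θᵀ * D)))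
      = -(φᵀ * φ) + η⁻¹ • (θᵀ * D - symPart (θᵀ * D)) := by
    rw [Matrix.mul_add, Matrix.mul_neg, Matrix.mul_smul, Matrix.mul_sub, Matrix.mul_assoc θ,
      ← Matrix.mul_assoc θᵀ θ, ← Matrix.mul_assoc θᵀ θ, hθ, Matrix.one_mul, Matrix.one_mul]
  rw [h1]
  have h2 : (φᵀ * φ)ᵀ = φᵀ * φ := by simp
  generalize φᵀ * φ = P at *
  generalize θᵀ * D = A
  ext i j
  have h3 : P j i = P i j := congrFun (congrFun h2 i) j
  simp [symPart, h3]
  ring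
end
end

section
/- Let n ≥ p be positive integers, let ℒ : ℝ^{n×p} → ℝ be differentiable with Euclidean gradient ∇ℒ, and let η, γ > 0. For any θ, φ ∈ ℝ^{n×p} with θᵀθ = I and Sym(θᵀφ) = 0, setting D = −γφ − ∇ℒ(θ), one has η·⟨φ, −θφᵀφ + (D − θ·Sym(θᵀD))/η⟩ + ⟨∇ℒ(θ), φ⟩ = −γ‖φ‖². Consequently, along any solution of the system θ' = φ, φ' = −θφᵀφ + (D − θ·Sym(θᵀD))/η that lies in the tangent bundle of the Stiefel manifold, the energy E(θ,φ) = (η/2)‖φ‖² + ℒ(θ) has time derivative −γ‖φ‖². -/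
open Matrix Set Filter

attribute [local instance] Matrix.normedAddCommGroup Matrix.normedSpace

noncomputable section

/-- The vector field giving `φ'` in system (4). -/
def phiDot {n p : ℕ} (η γ : ℝ)
    (G : Matrix (Fin n) (Fin p) ℝ → Matrix (Fin n) (Fin p) ℝ)
    (θ φ : Matrix (Fin n) (Fin p) ℝ) : Matrix (Fin n) (Fin p) ℝ :=
  -(θ * φᵀ * φ) +
    η⁻¹ • ((-(γ • φ) - G θ) - θ * symPart (θᵀ * (-(γ • φ) - G θ)))

theorem aux_skew {p : ℕ} (A S : Matrix (Fin p) (Fin p) ℝ) (hA : Aᵀ = -A) (hS : Sᵀ = S) :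
    (A * S).trace = 0 := by
  have h : (A * S).trace = -(A * S).trace := by
    conv_lhs => rw [← Matrix.trace_transpose, Matrix.transpose_mul, hA, hS, Matrix.mul_neg,
      Matrix.trace_neg, Matrix.trace_mul_comm]
  linarith

theorem aux_skew_of {n p : ℕ} (θ φ : Matrix (Fin n) (Fin p) ℝ) (h : symPart (θᵀ * φ) = 0) :
    (φᵀ * θ)ᵀ = -(φᵀ * θ) := by
  unfold symPart at h
  have h2 : θᵀ * φ + (θᵀ * φ)ᵀ = 0 := (smul_eq_zero.mp h).resolve_left (by norm_num)
  rw [Matrix.transpose_mul, Matrix.transpose_transpose] at h2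
  rw [Matrix.transpose_mul, Matrix.transpose_transpose]
  exact eq_neg_of_add_eq_zero_left h2

theorem aux_symm {p : ℕ} (A : Matrix (Fin p) (Fin p) ℝ) : (symPart A)ᵀ = symPart A := by
  unfold symPart
  rw [Matrix.transpose_smul, Matrix.transpose_add, Matrix.transpose_transpose, add_comm]

theorem aux_comm {n p : ℕ} (A B : Matrix (Fin n) (Fin p) ℝ) : mInner A B = mInner B A := by
  unfold mInner
  rw [← Matrix.trace_transpose, Matrix.transpose_mul, Matrix.transpose_transpose]

theorem aux_sum {n p : ℕ} (A B : Matrix (Fin n) (Fin p) ℝ) :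
    mInner A B = ∑ j, ∑ i, A i j * B i j := by
  simp [mInner, Matrix.trace, Matrix.mul_apply]

theorem aux_normsq {n p : ℕ} (A : Matrix (Fin n) (Fin p) ℝ) : mNorm A ^ 2 = mInner A A := by
  unfold mNorm
  apply Real.sq_sqrt
  rw [aux_sum]
  exact Finset.sum_nonneg fun j _ => Finset.sum_nonneg fun i _ => mul_self_nonneg _

theorem aux_id {n p : ℕ} (G : Matrix (Fin n) (Fin p) ℝ → Matrix (Fin n) (Fin p) ℝ)
    (η γ : ℝ) (hη : 0 < η) (θ φ : Matrix (Fin n) (Fin p) ℝ) (h : symPart (θᵀ * φ) = 0) :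
    η * mInner φ (phiDot η γ G θ φ) + mInner (G θ) φ = -(γ * mNorm φ ^ 2) := by
  have hs := aux_skew_of θ φ h
  have h1 := aux_skew (φᵀ * θ) (φᵀ * φ) hs (by simp [Matrix.transpose_mul])
  have h2 := aux_skew (φᵀ * θ) _ hs (aux_symm (θᵀ * (-(γ • φ) - G θ)))
  rw [aux_normsq, aux_comm (G θ)]
  unfold phiDot mInner
  generalize symPart (θᵀ * (-(γ • φ) - G θ)) = S at *
  rw [Matrix.mul_add, Matrix.mul_neg, Matrix.mul_smul, Matrix.mul_sub, Matrix.mul_sub,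
    Matrix.mul_neg, Matrix.mul_smul, Matrix.mul_assoc θ, ← Matrix.mul_assoc, ← Matrix.mul_assoc φᵀ θ S]
  simp only [Matrix.trace_add, Matrix.trace_neg, Matrix.trace_smul, Matrix.trace_sub, h1, h2,
    smul_eq_mul]
  field_simp
  ring

/-- the energy identity
`η·⟨φ, φ'⟩ + ⟨∇ℒ(θ), φ⟩ = -γ‖φ‖²` on the tangent bundle, and consequently along
solutions of the system lying in the tangent bundle the energy
`E(θ,φ) = (η/2)‖φ‖² + ℒ(θ)` has time derivative `-γ‖φ‖²`. -/
theorem stmt2 (n p : ℕ) (hp : 0 < p) (hpn : p ≤ n)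
    (L : Matrix (Fin n) (Fin p) ℝ → ℝ)
    (G : Matrix (Fin n) (Fin p) ℝ → Matrix (Fin n) (Fin p) ℝ)
    (L' : Matrix (Fin n) (Fin p) ℝ → (Matrix (Fin n) (Fin p) ℝ →L[ℝ] ℝ))
    (hLdiff : ∀ X, HasFDerivAt L (L' X) X)
    (hLgrad : ∀ X H, L' X H = mInner (G X) H)
    (η γ : ℝ) (hη : 0 < η) (hγ : 0 < γ) :
    (∀ θ φ : Matrix (Fin n) (Fin p) ℝ, θᵀ * θ = 1 → symPart (θᵀ * φ) = 0 →
        η * mInner φ (phiDot η γ G θ φ) + mInner (G θ) φ = -(γ * mNorm φ ^ 2)) ∧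
    (∀ θ φ : ℝ → Matrix (Fin n) (Fin p) ℝ,
        (∀ t, HasDerivAt θ (φ t) t) →
        (∀ t, HasDerivAt φ (phiDot η γ G (θ t) (φ t)) t) →
        (∀ t, (θ t)ᵀ * θ t = 1 ∧ symPart ((θ t)ᵀ * φ t) = 0) →
        ∀ t, HasDerivAt (fun s => η / 2 * mNorm (φ s) ^ 2 + L (θ s))
          (-(γ * mNorm (φ t) ^ 2)) t) := by
  refine ⟨fun θ φ _ h => aux_id G η γ hη θ φ h, ?_⟩
  intro θ φ hθ hφ hT t
  rw [← aux_id G η γ hη (θ t) (φ t) (hT t).2]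
  have hL : HasDerivAt (fun s => L (θ s)) (mInner (G (θ t)) (φ t)) t := by
    rw [← hLgrad]
    exact (hLdiff (θ t)).comp_hasDerivAt t (hθ t)
  have hent : ∀ i j, HasDerivAt (fun s => φ s i j) (phiDot η γ G (θ t) (φ t) i j) t :=
    fun i j => hasDerivAt_pi.mp (hasDerivAt_pi.mp (hφ t) i) j
  have hN : HasDerivAt (fun s => mNorm (φ s) ^ 2)
      (2 * mInner (φ t) (phiDot η γ G (θ t) (φ t))) t := by
    simp only [aux_normsq, aux_sum]
    have := HasDerivAt.fun_sum (u := Finset.univ) fun j _ =>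
      HasDerivAt.fun_sum (u := Finset.univ) fun i _ => (hent i j).fun_mul (hent i j)
    refine this.congr_deriv ?_
    simp only [Finset.mul_sum]
    refine Finset.sum_congr rfl fun j _ => Finset.sum_congr rfl fun i _ => ?_
    ring
  refine ((hN.const_mul (η / 2)).fun_add hL).congr_deriv ?_
  ring
end
end

section
/- Let n ≥ p be positive integers and η, γ > 0. Let c₀ ≥ 0 and let ℒ : ℝ^{n×p} → ℝ be twice continuously differentiable on an open set containing {θ ∈ St(n,p) : ℒ(θ) ≤ c₀}, with Euclidean gradient ∇ℒ. Assume θ* = arg min_{θ ∈ St(n,p)} ℒ(θ) exists uniquely, and let Ω = {(θ,φ) ∈ T St(n,p) : (η/2)‖φ‖² + ℒ(θ) ≤ c₀}; assume (θ*, 0) is the only point in {(θ,0) ∈ Ω : ∇ℒ(θ) − θ·Sym(θᵀ∇ℒ(θ)) = 0}. Then every solution (θ(t), φ(t)), t ≥ 0, of the system θ' = φ, φ' = −θφᵀφ + (D − θ·Sym(θᵀD))/η with D = −γφ − ∇ℒ(θ), that starts in Ω stays in Ω for all t ≥ 0 and converges to (θ*, 0) as t → ∞. -/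
open Matrix Set Filter

attribute [local instance] Matrix.normedAddCommGroup Matrix.normedSpace

noncomputable section

lemma aux_barbalat {V E : Type*} [NormedAddCommGroup V] [NormedAddCommGroup E] [NormedSpace ℝ E]
    {q : ℝ → V} {K : Set V} (hK : IsCompact K) {h : V → E} (hh : ContinuousOn h K)
    (hq : ∀ t ≥ (0 : ℝ), q t ∈ K) {C : ℝ}
    (hLip : ∀ s ≥ (0 : ℝ), ∀ t ≥ s, ‖q t - q s‖ ≤ C * (t - s))
    {f : ℝ → E} (hf : ∀ t ≥ (0 : ℝ), HasDerivAt f (h (q t)) t) {l : E}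
    (hl : Tendsto f atTop (nhds l)) : Tendsto (fun t => h (q t)) atTop (nhds 0) := by
  have huc := hK.uniformContinuousOn_of_continuous hh
  rw [Metric.uniformContinuousOn_iff] at huc
  rw [Metric.tendsto_atTop]
  intro ε hε
  obtain ⟨δ, hδ, hd⟩ := huc (ε / 2) (by positivity)
  obtain ⟨r, hr, hrC⟩ : ∃ r > 0, |C| * r < δ := by
    refine ⟨δ / (|C| + 1), by positivity, ?_⟩
    rw [mul_div_assoc', div_lt_iff₀ (by positivity)]
    nlinarith [abs_nonneg C]
  rw [Metric.tendsto_atTop] at hl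
  obtain ⟨N, hN⟩ := hl (ε * r / 4) (by positivity)
  refine ⟨max N 0, fun t ht => ?_⟩
  have htN : N ≤ t := le_trans (le_max_left _ _) ht
  have ht0 : 0 ≤ t := le_trans (le_max_right _ _) ht
  have key := norm_image_sub_le_of_norm_deriv_le_segment' (a := t) (b := t + r)
    (f := fun s => f s - s • h (q t)) (f' := fun s => h (q s) - (1 : ℝ) • h (q t)) (C := ε / 2)
    (fun s hs => ((hf s (ht0.trans hs.1)).sub ((hasDerivAt_id s).smul_const _)).hasDerivWithinAt)
    (fun s hs => by
      have h1 := hLip t ht0 s hs.1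
      have h2 := hd (q s) (hq s (ht0.trans hs.1)) (q t) (hq t ht0) (by
        rw [dist_eq_norm]
        refine lt_of_le_of_lt h1 (lt_of_le_of_lt ?_ hrC)
        have : s - t ≤ r := by linarith [hs.2]
        have h0 : 0 ≤ s - t := by linarith [hs.1]
        calc C * (s - t) ≤ |C| * (s - t) := by gcongr; exact le_abs_self C
          _ ≤ |C| * r := by gcongr)
      rw [dist_eq_norm] at h2
      rw [one_smul]; exact h2.le) (t + r) ⟨by linarith, le_rfl⟩
  have h3 : ‖f (t + r) - f t‖ < ε * r / 2 := by
    have a := hN t htN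
    have b := hN (t + r) (by linarith)
    rw [← dist_eq_norm]
    have := dist_triangle_right (f (t + r)) (f t) l
    linarith
  have h4 : r • h (q t) = (f (t + r) - f t) -
      ((f (t + r) - (t + r) • h (q t)) - (f t - t • h (q t))) := by
    rw [add_smul]; abel
  have h5 : r * ‖h (q t)‖ < ε * r := by
    calc r * ‖h (q t)‖ = ‖r • h (q t)‖ := by rw [norm_smul, Real.norm_of_nonneg hr.le]
      _ ≤ ‖f (t + r) - f t‖ + ‖(f (t + r) - (t + r) • h (q t)) - (f t - t • h (q t))‖ := by
          rw [h4]; exact norm_sub_le _ _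
      _ < ε * r := by nlinarith
  rw [dist_zero_right]
  nlinarith

lemma aux_cluster {V E : Type*} [TopologicalSpace V] [TopologicalSpace E] [T2Space E]
    {q : ℝ → V} {K : Set V} {h : V → E} (hh : ContinuousOn h K)
    (hq : ∀ t ≥ (0 : ℝ), q t ∈ K) {y : V} (hy : y ∈ K) (hc : MapClusterPt y atTop q) {l : E}
    (hl : Tendsto (fun t => h (q t)) atTop (nhds l)) : h y = l := by
  by_contra hne
  obtain ⟨A, B, hA, hB, hyA, hlB, hAB⟩ := t2_separation hne
  have h1 : ∀ᶠ x in nhds y, x ∈ K → h x ∈ A :=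
    eventually_nhdsWithin_iff.1 ((hh y hy).eventually (hA.mem_nhds hyA))
  have h2 : ∃ᶠ t in atTop, (q t ∈ K → h (q t) ∈ A) := hc.frequently h1
  have h3 : ∀ᶠ t in atTop, h (q t) ∈ B := hl (hB.mem_nhds hlB)
  obtain ⟨t, ht1, ht2, ht3⟩ := (h2.and_eventually (h3.and (eventually_ge_atTop (0:ℝ)))).exists
  exact Set.disjoint_left.1 hAB (ht1 (hq t ht3)) ht2

lemma aux_hasDeriv_iff {m k : ℕ} {A : ℝ → Matrix (Fin m) (Fin k) ℝ} {A' : Matrix (Fin m) (Fin k) ℝ}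
    {t : ℝ} : HasDerivAt A A' t ↔ ∀ i j, HasDerivAt (fun s => A s i j) (A' i j) t := by
  refine Iff.trans (hasDerivAt_pi (φ := A) (φ' := A')) ?_
  exact forall_congr' fun i => hasDerivAt_pi (φ := fun s => A s i) (φ' := A' i)

lemma aux_deriv_mul {m k l : ℕ} {A : ℝ → Matrix (Fin m) (Fin k) ℝ} {A' : Matrix (Fin m) (Fin k) ℝ}
    {B : ℝ → Matrix (Fin k) (Fin l) ℝ} {B' : Matrix (Fin k) (Fin l) ℝ}
    {t : ℝ} (hA : HasDerivAt A A' t) (hB : HasDerivAt B B' t) :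
    HasDerivAt (fun s => A s * B s) (A' * B t + A t * B') t := by
  rw [aux_hasDeriv_iff] at *
  intro i j
  simp only [Matrix.mul_apply, Matrix.add_apply, ← Finset.sum_add_distrib]
  exact HasDerivAt.fun_sum fun x _ => (hA i x).mul (hB x j)

lemma aux_deriv_tr {m k : ℕ} {A : ℝ → Matrix (Fin m) (Fin k) ℝ} {A' : Matrix (Fin m) (Fin k) ℝ}
    {t : ℝ} (hA : HasDerivAt A A' t) : HasDerivAt (fun s => (A s)ᵀ) (A'ᵀ) t := by
  rw [aux_hasDeriv_iff] at *
  exact fun i j => hA j i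

lemma aux_deriv_trace {m : ℕ} {A : ℝ → Matrix (Fin m) (Fin m) ℝ} {A' : Matrix (Fin m) (Fin m) ℝ}
    {t : ℝ} (hA : HasDerivAt A A' t) : HasDerivAt (fun s => (A s).trace) (A'.trace) t := by
  rw [aux_hasDeriv_iff] at *
  simp only [Matrix.trace, Matrix.diag]
  exact HasDerivAt.fun_sum fun x _ => hA x x

lemma aux_deriv_sym {m : ℕ} {A : ℝ → Matrix (Fin m) (Fin m) ℝ} {A' : Matrix (Fin m) (Fin m) ℝ}
    {t : ℝ} (hA : HasDerivAt A A' t) : HasDerivAt (fun s => symPart (A s)) (symPart A') t :=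
  (hA.add (aux_deriv_tr hA)).const_smul (1 / 2 : ℝ)

lemma aux_norm_mul {p : ℕ} (A B : Matrix (Fin p) (Fin p) ℝ) : ‖A * B‖ ≤ p * ‖A‖ * ‖B‖ := by
  rw [Matrix.norm_le_iff (by positivity)]
  intro i j
  rw [Matrix.mul_apply]
  refine (norm_sum_le _ _).trans ?_
  refine (Finset.sum_le_card_nsmul _ _ (‖A‖ * ‖B‖) fun x _ => ?_).trans ?_
  · rw [norm_mul]
    exact mul_le_mul (Matrix.norm_entry_le_entrywise_sup_norm A)
      (Matrix.norm_entry_le_entrywise_sup_norm B) (norm_nonneg _) (norm_nonneg _)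
  · simp [mul_assoc]

lemma aux_norm_sym {p : ℕ} (A : Matrix (Fin p) (Fin p) ℝ) : ‖symPart A‖ ≤ ‖A‖ := by
  unfold symPart
  rw [norm_smul]
  have := norm_add_le A Aᵀ
  rw [Matrix.norm_transpose] at this
  norm_num
  linarith

lemma aux_mInner_eq {m k : ℕ} (A B : Matrix (Fin m) (Fin k) ℝ) :
    mInner A B = ∑ j, ∑ i, A i j * B i j := by
  simp [mInner, Matrix.trace, Matrix.mul_apply]

lemma aux_mInner_nonneg {m k : ℕ} (A : Matrix (Fin m) (Fin k) ℝ) : 0 ≤ mInner A A := by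
  rw [aux_mInner_eq]
  exact Finset.sum_nonneg fun j _ => Finset.sum_nonneg fun i _ => mul_self_nonneg _

lemma aux_mNorm_sq {m k : ℕ} (A : Matrix (Fin m) (Fin k) ℝ) : mNorm A ^ 2 = mInner A A :=
  Real.sq_sqrt (aux_mInner_nonneg A)

lemma aux_norm_le {m k : ℕ} (A : Matrix (Fin m) (Fin k) ℝ) : ‖A‖ ^ 2 ≤ mInner A A := by
  have h : ‖A‖ ≤ Real.sqrt (mInner A A) := by
    rw [Matrix.norm_le_iff (Real.sqrt_nonneg _)]
    intro i j
    apply Real.le_sqrt_of_sq_le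
    rw [aux_mInner_eq, Real.norm_eq_abs, sq_abs, pow_two]
    refine le_trans ?_ (Finset.single_le_sum (f := fun j => ∑ i, A i j * A i j)
      (fun j _ => Finset.sum_nonneg fun i _ => mul_self_nonneg _) (Finset.mem_univ j))
    exact Finset.single_le_sum (f := fun i => A i j * A i j)
      (fun i _ => mul_self_nonneg _) (Finset.mem_univ i)
  calc ‖A‖ ^ 2 ≤ Real.sqrt (mInner A A) ^ 2 := by gcongr
    _ = _ := Real.sq_sqrt (aux_mInner_nonneg A)

lemma aux_mInner_cont {m k : ℕ} : Continuous fun A : Matrix (Fin m) (Fin k) ℝ => mInner A A := by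
  unfold mInner
  fun_prop

lemma aux_sym_cont {p : ℕ} : Continuous (symPart : Matrix (Fin p) (Fin p) ℝ → _) := by
  unfold symPart
  fun_prop

lemma aux_G_cont {n p : ℕ} {L : Matrix (Fin n) (Fin p) ℝ → ℝ}
    {G : Matrix (Fin n) (Fin p) ℝ → Matrix (Fin n) (Fin p) ℝ}
    {L' : Matrix (Fin n) (Fin p) ℝ → (Matrix (Fin n) (Fin p) ℝ →L[ℝ] ℝ)}
    (hLdiff : ∀ X, HasFDerivAt L (L' X) X)
    (hLgrad : ∀ X H, L' X H = mInner (G X) H) {U : Set (Matrix (Fin n) (Fin p) ℝ)}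
    (hU : IsOpen U) (hC : ContDiffOn ℝ 2 L U) : ContinuousOn G U := by
  have h1 : ContinuousOn L' U := by
    have := hC.continuousOn_fderiv_of_isOpen hU (by norm_num)
    exact this.congr fun X _ => (hLdiff X).fderiv.symm
  refine continuousOn_pi.2 fun i => continuousOn_pi.2 fun j => ?_
  have h2 : ∀ X, G X i j = L' X (Matrix.single i j 1) := by
    intro X
    rw [hLgrad, aux_mInner_eq]
    simp [Matrix.single_apply, ite_and]
  simp only [h2]
  exact h1.clm_apply continuousOn_const

lemma aux_energy {n p : ℕ} {η γ : ℝ} (hη : 0 < η)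
    {G : Matrix (Fin n) (Fin p) ℝ → Matrix (Fin n) (Fin p) ℝ}
    {θ φ : Matrix (Fin n) (Fin p) ℝ} (h : symPart (θᵀ * φ) = 0) :
    η * mInner φ (phiDot η γ G θ φ) + mInner (G θ) φ = -γ * mInner φ φ := by
  have hk : θᵀ * φ = -(φᵀ * θ) := by
    have : (θᵀ * φ) + (θᵀ * φ)ᵀ = 0 :=
      (smul_eq_zero.1 h).resolve_left (by norm_num)
    rw [Matrix.transpose_mul, Matrix.transpose_transpose] at this
    exact eq_neg_of_add_eq_zero_left this
  have hs : ∀ W : Matrix (Fin p) (Fin p) ℝ, Wᵀ = W → (φᵀ * (θ * W)).trace = 0 := by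
    intro W hW
    have h1 : (φᵀ * (θ * W)).trace = (W * (θᵀ * φ)).trace := by
      rw [← Matrix.trace_transpose]
      simp [Matrix.transpose_mul, hW, Matrix.mul_assoc]
    have h2 : (W * (θᵀ * φ)).trace = -(φᵀ * (θ * W)).trace := by
      rw [hk, Matrix.mul_neg, Matrix.trace_neg, Matrix.trace_mul_comm, Matrix.mul_assoc]
    linarith
  have h1 := hs (φᵀ * φ) (by simp)
  have h2 := hs (symPart (θᵀ * (-(γ • φ) - G θ))) (by
    simp only [symPart, Matrix.transpose_smul, Matrix.transpose_add, Matrix.transpose_transpose]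
    rw [add_comm])
  have h3 : ((G θ)ᵀ * φ).trace = (φᵀ * G θ).trace := by
    rw [← Matrix.trace_transpose]; simp
  unfold mInner phiDot
  rw [Matrix.mul_add, Matrix.trace_add, Matrix.mul_neg, Matrix.trace_neg, Matrix.mul_assoc θ, h1,
    Matrix.mul_smul, Matrix.trace_smul, Matrix.mul_sub, Matrix.trace_sub, h2, h3, Matrix.mul_sub,
    Matrix.trace_sub, Matrix.mul_neg, Matrix.trace_neg, Matrix.mul_smul, Matrix.trace_smul]
  simp only [smul_eq_mul]
  field_simp
  ring

/-- The symmetric part of the derivative of `θᵀφ`, with defect `S = θᵀθ - 1`. -/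
lemma aux_Pdot {n p : ℕ} {η γ : ℝ}
    {G : Matrix (Fin n) (Fin p) ℝ → Matrix (Fin n) (Fin p) ℝ}
    (θ φ : Matrix (Fin n) (Fin p) ℝ) :
    symPart (φᵀ * φ + θᵀ * phiDot η γ G θ φ) =
      -symPart ((θᵀ * θ - 1) * (φᵀ * φ + η⁻¹ • symPart (θᵀ * (-(γ • φ) - G θ)))) := by
  unfold phiDot
  generalize -(γ • φ) - G θ = D
  have : φᵀ * φ + θᵀ * (-(θ * φᵀ * φ) + η⁻¹ • (D - θ * symPart (θᵀ * D)))
    = -((θᵀ * θ - 1) * (φᵀ * φ + η⁻¹ • symPart (θᵀ * D))) +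
      η⁻¹ • (θᵀ * D - symPart (θᵀ * D)) := by
    simp only [Matrix.mul_add, Matrix.mul_neg, Matrix.sub_mul, Matrix.mul_smul, Matrix.mul_sub,
      Matrix.one_mul, Matrix.mul_assoc, smul_sub]
    abel
  rw [this]
  generalize (θᵀ * θ - 1) * (φᵀ * φ + η⁻¹ • symPart (θᵀ * D)) = Z
  generalize θᵀ * D = Y
  ext i j
  simp [symPart]
  ring

lemma aux_phiDot_cont {n p : ℕ} {η γ : ℝ}
    {G : Matrix (Fin n) (Fin p) ℝ → Matrix (Fin n) (Fin p) ℝ}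
    {K : Set (Matrix (Fin n) (Fin p) ℝ × Matrix (Fin n) (Fin p) ℝ)}
    (hGK : ContinuousOn (fun q : Matrix (Fin n) (Fin p) ℝ × Matrix (Fin n) (Fin p) ℝ => G q.1) K) :
    ContinuousOn (fun q : Matrix (Fin n) (Fin p) ℝ × Matrix (Fin n) (Fin p) ℝ =>
      phiDot η γ G q.1 q.2) K := by
  have hcont : Continuous fun x : (Matrix (Fin n) (Fin p) ℝ × Matrix (Fin n) (Fin p) ℝ) ×
      Matrix (Fin n) (Fin p) ℝ => -(x.1.1 * x.1.2ᵀ * x.1.2) + η⁻¹ • ((-(γ • x.1.2) - x.2) -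
        x.1.1 * symPart (x.1.1ᵀ * (-(γ • x.1.2) - x.2))) := by
    unfold symPart
    fun_prop
  have hpair : ContinuousOn (fun q : Matrix (Fin n) (Fin p) ℝ × Matrix (Fin n) (Fin p) ℝ =>
      (q, G q.1)) K := continuous_id.continuousOn.prodMk hGK
  have := Continuous.comp_continuousOn hcont hpair
  unfold phiDot
  exact this

set_option maxHeartbeats 1000000 in
/-- Lemma 2: asymptotic convergence to the unique minimizer. -/
theorem stmt4 (n p : ℕ) (hp : 0 < p) (hpn : p ≤ n)
    (η γ : ℝ) (hη : 0 < η) (hγ : 0 < γ)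
    (c₀ : ℝ) (hc₀ : 0 ≤ c₀)
    (L : Matrix (Fin n) (Fin p) ℝ → ℝ)
    (G : Matrix (Fin n) (Fin p) ℝ → Matrix (Fin n) (Fin p) ℝ)
    (L' : Matrix (Fin n) (Fin p) ℝ → (Matrix (Fin n) (Fin p) ℝ →L[ℝ] ℝ))
    (hLdiff : ∀ X, HasFDerivAt L (L' X) X)
    (hLgrad : ∀ X H, L' X H = mInner (G X) H)
    -- `ℒ` is `C²` on an open set containing `{θ ∈ St(n,p) : ℒ(θ) ≤ c₀}`
    (hC2 : ∃ U : Set (Matrix (Fin n) (Fin p) ℝ), IsOpen U ∧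
      {X | Xᵀ * X = 1 ∧ L X ≤ c₀} ⊆ U ∧ ContDiffOn ℝ 2 L U)
    -- `θstar` is the unique minimizer of `ℒ` over the Stiefel manifold
    (θstar : Matrix (Fin n) (Fin p) ℝ)
    (hstarSt : θstarᵀ * θstar = 1)
    (hstarMin : ∀ X : Matrix (Fin n) (Fin p) ℝ, Xᵀ * X = 1 → L θstar ≤ L X)
    (hstarUniq : ∀ X : Matrix (Fin n) (Fin p) ℝ, Xᵀ * X = 1 →
      (∀ Y : Matrix (Fin n) (Fin p) ℝ, Yᵀ * Y = 1 → L X ≤ L Y) → X = θstar)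
    -- `Ω` is the energy sublevel set within the tangent bundle
    (Ω : Set (Matrix (Fin n) (Fin p) ℝ × Matrix (Fin n) (Fin p) ℝ))
    (hΩ : Ω = {q | (q.1ᵀ * q.1 : Matrix (Fin p) (Fin p) ℝ) = 1 ∧ symPart (q.1ᵀ * q.2) = 0 ∧
      η / 2 * mNorm q.2 ^ 2 + L q.1 ≤ c₀})
    -- `(θstar, 0)` is the only point of `Ω` of the form `(θ, 0)` with
    -- vanishing Riemannian gradient
    (hOnlyCrit : ∀ X : Matrix (Fin n) (Fin p) ℝ, (X, (0 : Matrix (Fin n) (Fin p) ℝ)) ∈ Ω →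
      G X - X * symPart (Xᵀ * G X) = 0 → X = θstar)
    -- a solution of system (4) starting in `Ω`
    (θ φ : ℝ → Matrix (Fin n) (Fin p) ℝ)
    (hθ : ∀ t ≥ (0 : ℝ), HasDerivAt θ (φ t) t)
    (hφ : ∀ t ≥ (0 : ℝ), HasDerivAt φ (phiDot η γ G (θ t) (φ t)) t)
    (h0 : (θ 0, φ 0) ∈ Ω) :
    (∀ t ≥ (0 : ℝ), (θ t, φ t) ∈ Ω) ∧
    Filter.Tendsto (fun t => (θ t, φ t)) Filter.atTop
      (nhds (θstar, (0 : Matrix (Fin n) (Fin p) ℝ))) := by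
  obtain ⟨U, hU, hsub, hC⟩ := hC2
  have hG : ContinuousOn G U := aux_G_cont hLdiff hLgrad hU hC
  have hLc : Continuous L := continuous_iff_continuousAt.2 fun X => (hLdiff X).continuousAt
  have hθc : ∀ t ≥ (0 : ℝ), ContinuousAt θ t := fun t ht => (hθ t ht).continuousAt
  have hφc : ∀ t ≥ (0 : ℝ), ContinuousAt φ t := fun t ht => (hφ t ht).continuousAt
  have hmem : ∀ q, q ∈ Ω ↔ (q.1ᵀ * q.1 : Matrix (Fin p) (Fin p) ℝ) = 1 ∧
      symPart (q.1ᵀ * q.2) = 0 ∧ η / 2 * mInner q.2 q.2 + L q.1 ≤ c₀ := by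
    intro q; rw [hΩ, Set.mem_ofPred_eq, aux_mNorm_sq]
  have hΩU : ∀ q ∈ Ω, q.1 ∈ U := by
    intro q hq
    have h := (hmem q).1 hq
    have := aux_mInner_nonneg q.2
    exact hsub ⟨h.1, by nlinarith [h.2.2, mul_nonneg hη.le this]⟩
  have hΩcl : IsClosed Ω := by
    have : Ω = {q | (q.1ᵀ * q.1 : Matrix (Fin p) (Fin p) ℝ) = 1} ∩
      ({q | symPart (q.1ᵀ * q.2) = 0} ∩ {q | η / 2 * mInner q.2 q.2 + L q.1 ≤ c₀}) := by
      ext q; exact hmem q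
    rw [this]
    refine IsClosed.inter ?_ (IsClosed.inter ?_ ?_)
    · exact isClosed_eq (by fun_prop) continuous_const
    · exact isClosed_eq (aux_sym_cont.comp (by fun_prop)) continuous_const
    · exact isClosed_le ((continuous_const.mul (aux_mInner_cont.comp continuous_snd)).add
        (hLc.comp continuous_fst)) continuous_const
  have hΩb : Bornology.IsBounded Ω := by
    have hb : ∀ q ∈ Ω, ‖q‖ ≤ (p : ℝ) + (2 / η * (c₀ - L θstar) + 1) := by
      intro q hq
      obtain ⟨h1, -, h3⟩ := (hmem q).1 hq
      have hm := hstarMin q.1 h1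
      have a1 := aux_norm_le q.1
      have a2 := aux_norm_le q.2
      have e1 : mInner q.1 q.1 = p := by simp [mInner, h1]
      have e2 : mInner q.2 q.2 ≤ 2 / η * (c₀ - L θstar) := by
        rw [div_mul_eq_mul_div, le_div_iff₀ hη]; nlinarith
      have e3 : 0 ≤ mInner q.2 q.2 := aux_mInner_nonneg _
      have hp1 : (1 : ℝ) ≤ p := by exact_mod_cast hp
      rw [e1] at a1
      rw [Prod.norm_def]
      refine max_le ?_ ?_
      · nlinarith [norm_nonneg q.1]
      · nlinarith [norm_nonneg q.2, sq_nonneg (‖q.2‖ - 1)]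
    exact isBounded_iff_forall_norm_le.2 ⟨_, hb⟩
  have hΩk : IsCompact Ω := Metric.isCompact_of_isClosed_isBounded hΩcl hΩb
  -- energy derivative
  set E : ℝ → ℝ := fun t => η / 2 * mInner (φ t) (φ t) + L (θ t) with hE
  have hEd : ∀ t ≥ (0 : ℝ), symPart ((θ t)ᵀ * φ t) = 0 →
      HasDerivAt E (-γ * mInner (φ t) (φ t)) t := by
    intro t ht hs
    have h1 := aux_deriv_trace (aux_deriv_mul (aux_deriv_tr (hφ t ht)) (hφ t ht))
    have h2 := ((hLdiff (θ t)).comp_hasDerivAt t (hθ t ht)).congr_deriv (hLgrad _ _)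
    have h3 := (h1.const_mul (η / 2)).add h2
    have h4 := aux_energy (γ := γ) (G := G) hη hs
    have h5 : ((phiDot η γ G (θ t) (φ t))ᵀ * φ t).trace = mInner (φ t) (phiDot η γ G (θ t) (φ t)) := by
      rw [← Matrix.trace_transpose]; simp [mInner]
    rw [Matrix.trace_add, h5] at h3
    change HasDerivAt E (η / 2 * (mInner (φ t) (phiDot η γ G (θ t) (φ t)) +
      mInner (φ t) (phiDot η γ G (θ t) (φ t))) + mInner (G (θ t)) (φ t)) t at h3
    convert h3 using 1
    rw [← h4]; ring
  have hEc : ∀ t ≥ (0 : ℝ), ContinuousAt E t := by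
    intro t ht
    exact (continuousAt_const.mul (aux_mInner_cont.continuousAt.comp (hφc t ht))).add
      (hLc.continuousAt.comp (hθc t ht))
  -- energy decay on intervals
  have hEanti : ∀ a ≥ (0 : ℝ), ∀ b, (∀ t ∈ Set.Icc a b, symPart ((θ t)ᵀ * φ t) = 0) →
      AntitoneOn E (Set.Icc a b) := by
    intro a ha b h
    refine antitoneOn_of_deriv_nonpos (convex_Icc a b)
      (fun t ht => (hEc t (ha.trans ht.1)).continuousWithinAt) ?_ ?_
    · intro t ht
      have ht := interior_subset ht
      exact (hEd t (ha.trans ht.1) (h t ht)).differentiableAt.differentiableWithinAt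
    · intro t ht
      have ht := interior_subset ht
      rw [(hEd t (ha.trans ht.1) (h t ht)).deriv]
      have := mul_nonneg hγ.le (aux_mInner_nonneg (φ t))
      linarith
  have hq : ∀ t ≥ (0 : ℝ), ContinuousAt (fun t => (θ t, φ t)) t := fun t ht =>
    (hθc t ht).prodMk (hφc t ht)
  -- invariance
  have hinv : ∀ t ≥ (0 : ℝ), (θ t, φ t) ∈ Ω := by
    intro T hT
    have hcl : IsClosed ({t | (θ t, φ t) ∈ Ω} ∩ Set.Icc 0 T) := by
      rw [Set.inter_comm]
      exact ContinuousOn.preimage_isClosed_of_isClosed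
        (fun t ht => (hq t ht.1).continuousWithinAt) isClosed_Icc hΩcl
    refine hcl.Icc_subset_of_forall_mem_nhdsWithin h0 ?_ ⟨hT, le_rfl⟩
    rintro a ⟨haΩ, ha0, -⟩
    obtain ⟨m1, m2, m3⟩ := (hmem _).1 haΩ
    simp only at m1 m2 m3
    set M : ℝ → Matrix (Fin p) (Fin p) ℝ := fun s =>
      (φ s)ᵀ * φ s + η⁻¹ • symPart ((θ s)ᵀ * (-(γ • φ s) - G (θ s))) with hM
    have hGa : ContinuousAt (fun s => G (θ s)) a :=
      ContinuousAt.comp (g := G) (hG.continuousAt (hU.mem_nhds (hΩU _ haΩ))) (hθc a ha0)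
    have hMc : ContinuousAt M a := by
      have c1 := hθc a ha0
      have c2 := hφc a ha0
      have c3 : ContinuousAt (fun s => (θ s)ᵀ * (-(γ • φ s) - G (θ s))) a := by
        have d1 : ContinuousAt (fun s => -(γ • φ s) - G (θ s)) a := ((c2.const_smul γ).neg).sub hGa
        have := (show Continuous fun x : Matrix (Fin n) (Fin p) ℝ × Matrix (Fin n) (Fin p) ℝ =>
          x.1ᵀ * x.2 by fun_prop)
        exact ContinuousAt.comp (g := fun x : Matrix (Fin n) (Fin p) ℝ × Matrix (Fin n) (Fin p) ℝ =>
          x.1ᵀ * x.2) this.continuousAt (c1.prodMk d1)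
      have c4 : ContinuousAt (fun s => (φ s)ᵀ * φ s) a :=
        ContinuousAt.comp (g := fun x : Matrix (Fin n) (Fin p) ℝ => xᵀ * x)
          (by fun_prop) c2
      exact c4.add ((aux_sym_cont.continuousAt.comp c3).const_smul η⁻¹)
    have hMb : ∀ᶠ s in nhds a, ‖M s‖ < ‖M a‖ + 1 :=
      hMc.norm.eventually (gt_mem_nhds (by linarith))
    obtain ⟨δ, hδ, hMδ⟩ := Metric.eventually_nhds_iff.1 hMb
    set u : ℝ → Matrix (Fin p) (Fin p) ℝ × Matrix (Fin p) (Fin p) ℝ := fun s =>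
      ((θ s)ᵀ * θ s - 1, symPart ((θ s)ᵀ * φ s)) with hu
    have hud : ∀ s ≥ (0 : ℝ), HasDerivAt u
        ((2 : ℝ) • symPart ((θ s)ᵀ * φ s), -symPart (((θ s)ᵀ * θ s - 1) * M s)) s := by
      intro s hs
      refine HasDerivAt.prodMk ?_ ?_
      · have h := (aux_deriv_mul (aux_deriv_tr (hθ s hs)) (hθ s hs)).sub_const
          (1 : Matrix (Fin p) (Fin p) ℝ)
        convert h using 1
        simp [symPart, smul_smul, add_comm]
      · have h := aux_deriv_sym (aux_deriv_mul (aux_deriv_tr (hθ s hs)) (hφ s hs))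
        rw [aux_Pdot] at h
        exact h
    have huz : ∀ s ∈ Set.Icc a (a + δ / 2), u s = 0 := by
      refine eq_zero_of_abs_deriv_le_mul_abs_self_of_eq_zero_right
        (K := 2 + p * (‖M a‖ + 1))
        (fun s hs => (hud s (ha0.trans hs.1)).continuousAt.continuousWithinAt)
        (fun s hs => (hud s (ha0.trans hs.1)).hasDerivWithinAt) ?_ ?_
      · simp [hu, m1, m2]
      · intro s hs
        have hMs : ‖M s‖ < ‖M a‖ + 1 := hMδ (by
          rw [Real.dist_eq, abs_of_nonneg (by linarith [hs.1])]; linarith [hs.2])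
        have n1 : ‖(θ s)ᵀ * θ s - 1‖ ≤ ‖u s‖ := norm_fst_le (u s)
        have n2 : ‖symPart ((θ s)ᵀ * φ s)‖ ≤ ‖u s‖ := norm_snd_le (u s)
        have n0 := norm_nonneg (u s)
        have n3 := norm_nonneg (M a)
        rw [Prod.norm_def]
        refine max_le ?_ ?_
        · simp only [norm_smul, Real.norm_ofNat]
          have : 0 ≤ (p : ℝ) * (‖M a‖ + 1) * ‖u s‖ := by positivity
          nlinarith
        · simp only [norm_neg]
          calc _ ≤ _ := aux_norm_sym _
            _ ≤ _ := aux_norm_mul _ _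
            _ ≤ p * ‖u s‖ * (‖M a‖ + 1) := by gcongr
            _ ≤ _ := by nlinarith
    have hEa := hEanti a ha0 (a + δ / 2) (fun t ht => congrArg Prod.snd (huz t ht))
    refine mem_of_superset (Ioc_mem_nhdsGT (show a < a + δ / 2 by linarith)) ?_
    intro s hs
    have hs' : s ∈ Set.Icc a (a + δ / 2) := ⟨hs.1.le, hs.2⟩
    refine (hmem _).2 ⟨sub_eq_zero.1 (congrArg Prod.fst (huz s hs')),
      congrArg Prod.snd (huz s hs'), ?_⟩
    exact (hEa ⟨le_rfl, by linarith⟩ hs' hs.1.le).trans m3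
  refine ⟨hinv, ?_⟩
  have hinv' : ∀ t ≥ (0 : ℝ), _ := fun t ht => (hmem _).1 (hinv t ht)
  -- the vector field is continuous on `Ω`
  have hGΩ : ContinuousOn (fun q : Matrix (Fin n) (Fin p) ℝ × Matrix (Fin n) (Fin p) ℝ => G q.1) Ω :=
    hG.comp continuous_fst.continuousOn hΩU
  have hF : ContinuousOn (fun q : Matrix (Fin n) (Fin p) ℝ × Matrix (Fin n) (Fin p) ℝ =>
      phiDot η γ G q.1 q.2) Ω := aux_phiDot_cont hGΩ
  have hFF : ContinuousOn (fun q : Matrix (Fin n) (Fin p) ℝ × Matrix (Fin n) (Fin p) ℝ =>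
      (q.2, phiDot η γ G q.1 q.2)) Ω := continuous_snd.continuousOn.prodMk hF
  obtain ⟨C, hCb⟩ := hΩk.exists_bound_of_continuousOn hFF
  have hCb' : ∀ x ≥ (0 : ℝ), ‖(φ x, phiDot η γ G (θ x) (φ x))‖ ≤ C := fun x hx =>
    hCb (θ x, φ x) (hinv x hx)
  have hLip : ∀ s ≥ (0 : ℝ), ∀ t ≥ s, ‖(θ t, φ t) - (θ s, φ s)‖ ≤ C * (t - s) := by
    intro s hs t ht
    exact norm_image_sub_le_of_norm_deriv_le_segment' (f := fun t => (θ t, φ t))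
      (f' := fun t => (φ t, phiDot η γ G (θ t) (φ t))) (a := s) (b := t)
      (fun x hx => ((hθ x (hs.trans hx.1)).prodMk (hφ x (hs.trans hx.1))).hasDerivWithinAt)
      (fun x hx => hCb' x (hs.trans hx.1)) t ⟨ht, le_rfl⟩
  -- the energy converges
  have hElim : ∃ l, Tendsto E atTop (nhds l) := by
    have ha : Antitone fun t => E (max t 0) := by
      intro s t hst
      have := hEanti 0 le_rfl (max t 0) (fun x hx => (hinv' x hx.1).2.1)
      exact this ⟨le_max_right _ _, max_le_max_right 0 hst⟩ ⟨le_max_right _ _, le_rfl⟩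
        (max_le_max_right 0 hst)
    have hb : BddBelow (Set.range fun t => E (max t 0)) := by
      refine ⟨L θstar, ?_⟩
      rintro _ ⟨t, rfl⟩
      have h1 := hstarMin _ (hinv' (max t 0) (le_max_right _ _)).1
      have h2 := mul_nonneg (half_pos hη).le (aux_mInner_nonneg (φ (max t 0)))
      simp only [hE]
      linarith
    refine ⟨_, (tendsto_atTop_ciInf ha hb).congr' ?_⟩
    filter_upwards [eventually_ge_atTop (0 : ℝ)] with t ht
    rw [max_eq_left ht]
  obtain ⟨l, hl⟩ := hElim
  have hk1 : Tendsto (fun t => -γ * mInner (φ t) (φ t)) atTop (nhds 0) :=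
    aux_barbalat (q := fun t => (θ t, φ t)) hΩk
      (h := fun q : Matrix (Fin n) (Fin p) ℝ × Matrix (Fin n) (Fin p) ℝ => -γ * mInner q.2 q.2)
      (continuous_const.mul (aux_mInner_cont.comp continuous_snd)).continuousOn hinv hLip
      (fun t ht => hEd t ht (hinv' t ht).2.1) hl
  have hφ0 : Tendsto φ atTop (nhds 0) := by
    have h1 : Tendsto (fun t => mInner (φ t) (φ t)) atTop (nhds 0) := by
      have := hk1.const_mul (-γ)⁻¹
      rw [mul_zero] at this
      refine this.congr fun t => ?_
      field_simp
    refine tendsto_zero_iff_norm_tendsto_zero.2 ?_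
    have h2 := h1.sqrt
    rw [Real.sqrt_zero] at h2
    refine squeeze_zero (fun t => norm_nonneg _) (fun t => ?_) h2
    exact Real.le_sqrt_of_sq_le (aux_norm_le _)
  have hk2 : Tendsto (fun t => phiDot η γ G (θ t) (φ t)) atTop (nhds 0) :=
    aux_barbalat (q := fun t => (θ t, φ t)) hΩk
      (h := fun q : Matrix (Fin n) (Fin p) ℝ × Matrix (Fin n) (Fin p) ℝ => phiDot η γ G q.1 q.2)
      hF hinv hLip hφ hφ0
  refine hΩk.tendsto_nhds_of_unique_mapClusterPt
    ((eventually_ge_atTop (0 : ℝ)).mono fun t ht => hinv t ht) ?_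
  rintro ⟨X, Y⟩ hy hc
  have hY : Y = 0 := aux_cluster (q := fun t => (θ t, φ t)) continuous_snd.continuousOn hinv hy hc hφ0
  subst hY
  have hX := aux_cluster (q := fun t => (θ t, φ t)) hF hinv hy hc hk2
  have hXs : X = θstar := by
    refine hOnlyCrit X hy ?_
    have e1 : symPart (-(Xᵀ * G X)) = -symPart (Xᵀ * G X) := by
      simp [symPart]
      abel
    have e : η = 0 ∨ -G X - X * symPart (-(Xᵀ * G X)) = 0 := by
      simpa [phiDot] using hX
    have e2 := e.resolve_left hη.ne'
    rw [e1, Matrix.mul_neg] at e2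
    rw [← neg_eq_zero, ← e2]; abel
  rw [hXs]
end
end

section
/- Let n ≥ p be positive integers and k₁, k₂ > 0, and define V(θ,φ) = (k₁/4)‖θᵀθ − I‖² + (k₂/2)‖Sym(θᵀφ)‖² for θ, φ ∈ ℝ^{n×p}, with gradient ∇V(θ,φ) = (k₁θ(θᵀθ − I) + k₂φ·Sym(θᵀφ), k₂θ·Sym(θᵀφ)). For each 0 < c < k₁/4, the set of all critical points of V in V^{-1}([0,c]) is exactly V^{-1}(0); that is, if V(θ,φ) ≤ c and ∇V(θ,φ) = (0,0), then θᵀθ = I and Sym(θᵀφ) = 0. -/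
open Matrix Set Filter

attribute [local instance] Matrix.normedAddCommGroup Matrix.normedSpace

noncomputable section

/-- `V(θ,φ) = (k₁/4)‖θᵀθ - I‖² + (k₂/2)‖Sym(θᵀφ)‖²`. -/
def Vfun {n p : ℕ} (k₁ k₂ : ℝ)
    (q : Matrix (Fin n) (Fin p) ℝ × Matrix (Fin n) (Fin p) ℝ) : ℝ :=
  k₁ / 4 * mNorm (q.1ᵀ * q.1 - 1) ^ 2 + k₂ / 2 * mNorm (symPart (q.1ᵀ * q.2)) ^ 2

/-- `∇V(θ,φ) = (k₁θ(θᵀθ - I) + k₂φ·Sym(θᵀφ), k₂θ·Sym(θᵀφ))`. -/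
def gradV {n p : ℕ} (k₁ k₂ : ℝ)
    (q : Matrix (Fin n) (Fin p) ℝ × Matrix (Fin n) (Fin p) ℝ) :
    Matrix (Fin n) (Fin p) ℝ × Matrix (Fin n) (Fin p) ℝ :=
  (k₁ • (q.1 * (q.1ᵀ * q.1 - 1)) + k₂ • (q.2 * symPart (q.1ᵀ * q.2)),
    k₂ • (q.1 * symPart (q.1ᵀ * q.2)))

theorem mNorm_sq {m k : ℕ} (A : Matrix (Fin m) (Fin k) ℝ) :
    mNorm A ^ 2 = ∑ j, ∑ i, A i j ^ 2 := by
  have h : mInner A A = ∑ j, ∑ i, A i j ^ 2 := by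
    simp [mInner, Matrix.trace, Matrix.mul_apply, pow_two]
  have h0 : 0 ≤ mInner A A := by rw [h]; positivity
  rw [mNorm, Real.sq_sqrt h0, h]

theorem mNorm_sq_eq_zero {m k : ℕ} {A : Matrix (Fin m) (Fin k) ℝ}
    (h : mNorm A ^ 2 = 0) : A = 0 := by
  rw [mNorm_sq, Finset.sum_eq_zero_iff_of_nonneg (fun _ _ => by positivity)] at h
  ext i j
  have h2 := h j (Finset.mem_univ j)
  rw [Finset.sum_eq_zero_iff_of_nonneg (fun _ _ => by positivity)] at h2
  exact pow_eq_zero_iff (two_ne_zero) |>.1 (h2 i (Finset.mem_univ i))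

theorem mNorm_sq_mul_le {m k l : ℕ} (A : Matrix (Fin m) (Fin k) ℝ)
    (B : Matrix (Fin k) (Fin l) ℝ) :
    mNorm (A * B) ^ 2 ≤ mNorm A ^ 2 * mNorm B ^ 2 := by
  rw [mNorm_sq, mNorm_sq, mNorm_sq, Finset.mul_sum]
  refine Finset.sum_le_sum fun j _ => ?_
  rw [Finset.sum_comm, Finset.sum_mul]
  refine Finset.sum_le_sum fun i _ => ?_
  rw [Matrix.mul_apply]
  exact Finset.sum_mul_sq_le_sq_mul_sq _ _ _

theorem cancel_of_lt {n p l : ℕ} (θ : Matrix (Fin n) (Fin p) ℝ)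
    (h : mNorm (θᵀ * θ - 1) ^ 2 < 1) (B : Matrix (Fin p) (Fin l) ℝ) (hB : θ * B = 0) :
    B = 0 := by
  have h1 : (θᵀ * θ - 1) * B = -B := by
    rw [Matrix.sub_mul, Matrix.mul_assoc, hB]; simp
  have h2 := mNorm_sq_mul_le (θᵀ * θ - 1) B
  have h3 : mNorm (-B) ^ 2 = mNorm B ^ 2 := by simp [mNorm_sq]
  rw [h1, h3] at h2
  apply mNorm_sq_eq_zero
  nlinarith [sq_nonneg (mNorm B)]

theorem crit_aux {n p : ℕ} {k₁ k₂ : ℝ} (hk₁ : 0 < k₁) (hk₂ : 0 < k₂)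
    {c : ℝ} (hck : c < k₁ / 4) (θ φ : Matrix (Fin n) (Fin p) ℝ)
    (hV : Vfun k₁ k₂ (θ, φ) ≤ c) (hg : gradV k₁ k₂ (θ, φ) = 0) :
    θᵀ * θ = 1 ∧ symPart (θᵀ * φ) = 0 := by
  simp only [Vfun] at hV
  simp only [gradV, Prod.mk_eq_zero] at hg
  obtain ⟨hg1, hg2⟩ := hg
  have hlt : mNorm (θᵀ * θ - 1) ^ 2 < 1 := by
    have : 0 ≤ k₂ / 2 * mNorm (symPart (θᵀ * φ)) ^ 2 := by positivity
    by_contra! hge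
    nlinarith
  have hS : symPart (θᵀ * φ) = 0 :=
    cancel_of_lt θ hlt _ ((smul_eq_zero.1 hg2).resolve_left hk₂.ne')
  rw [hS, Matrix.mul_zero, smul_zero, add_zero] at hg1
  exact ⟨sub_eq_zero.1 (cancel_of_lt θ hlt _ ((smul_eq_zero.1 hg1).resolve_left hk₁.ne')), hS⟩

/-- Lemma 3: for `0 < c < k₁/4`, the set of critical points of `V`
in `V⁻¹([0,c])` is exactly `V⁻¹(0)`. -/
theorem stmt5 (n p : ℕ) (hp : 0 < p) (hpn : p ≤ n)
    (k₁ k₂ : ℝ) (hk₁ : 0 < k₁) (hk₂ : 0 < k₂)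
    (c : ℝ) (hc0 : 0 < c) (hck : c < k₁ / 4) :
    {q : Matrix (Fin n) (Fin p) ℝ × Matrix (Fin n) (Fin p) ℝ |
        Vfun k₁ k₂ q ∈ Set.Icc 0 c ∧ gradV k₁ k₂ q = 0} =
      {q | Vfun k₁ k₂ q = 0} ∧
    ∀ θ φ : Matrix (Fin n) (Fin p) ℝ, Vfun k₁ k₂ (θ, φ) ≤ c →
      gradV k₁ k₂ (θ, φ) = 0 → θᵀ * θ = 1 ∧ symPart (θᵀ * φ) = 0 := by
  refine ⟨?_, fun θ φ hV hg => crit_aux hk₁ hk₂ hck θ φ hV hg⟩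
  ext ⟨θ, φ⟩
  simp only [Set.mem_setOf_eq]
  constructor
  · rintro ⟨⟨_, hV⟩, hg⟩
    obtain ⟨h1, h2⟩ := crit_aux hk₁ hk₂ hck θ φ hV hg
    simp [Vfun, h1, h2, mNorm_sq]
  · intro h
    refine ⟨⟨h.ge, h.trans_le hc0.le⟩, ?_⟩
    simp only [Vfun] at h
    have a1 : 0 ≤ k₁ / 4 * mNorm (θᵀ * θ - 1) ^ 2 := by positivity
    have a2 : 0 ≤ k₂ / 2 * mNorm (symPart (θᵀ * φ)) ^ 2 := by positivity
    have b1 : k₁ / 4 * mNorm (θᵀ * θ - 1) ^ 2 = 0 := by linarith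
    have b2 : k₂ / 2 * mNorm (symPart (θᵀ * φ)) ^ 2 = 0 := by linarith
    have c1 := mNorm_sq_eq_zero ((mul_eq_zero.1 b1).resolve_left (by positivity))
    have c2 := mNorm_sq_eq_zero ((mul_eq_zero.1 b2).resolve_left (by positivity))
    simp [gradV, c1, c2]
end
end

section
/- Let n ≥ p be positive integers, k₁, k₂, α > 0, and let W = {(θ,φ) ∈ ℝ^{n×p}×ℝ^{n×p} : ‖θᵀθ − I‖ < 1}. With ∇V(θ,φ) = (∇_θV, ∇_φV) = (k₁θ(θᵀθ − I) + k₂φ·Sym(θᵀφ), k₂θ·Sym(θᵀφ)) and L(θ,φ) the block operator with blocks A = (1/(4k₁))θ(θᵀθ)^{-2}θᵀ, L₁ = −(1/(4k₁))θ(θᵀθ)^{-2}θᵀφ(θᵀθ)^{-1}θᵀ, L₂ = (1/(4k₁))θ(θᵀθ)^{-1}φᵀθ(θᵀθ)^{-2}θᵀφ(θᵀθ)^{-1}θᵀ + (1/(2k₂))θ(θᵀθ)^{-2}θᵀ, for every (θ,φ) ∈ W the feedback term of the modified dynamics equals α·L(θ,φ)∇V(θ,φ); that is, (α/4)·θ(I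 − (θᵀθ)^{-1}) = α(A∇_θV + L₁∇_φV) and (α/4)·θ(θᵀθ)^{-1}(φᵀθ(θᵀθ)^{-1} + θᵀφ) = α(L₁ᵀ∇_θV + L₂∇_φV). -/
open Matrix Set Filter

attribute [local instance] Matrix.normedAddCommGroup Matrix.normedSpace

noncomputable section

/-- The block `A = (1/(4k₁))θ(θᵀθ)⁻²θᵀ` of the operator `L(θ,φ)`. -/
def Lblk {n p : ℕ} (k₁ : ℝ) (θ : Matrix (Fin n) (Fin p) ℝ) :
    Matrix (Fin n) (Fin n) ℝ :=
  (1 / (4 * k₁)) • (θ * ((θᵀ * θ)⁻¹ * (θᵀ * θ)⁻¹) * θᵀ)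

/-- The block `L₁ = -(1/(4k₁))θ(θᵀθ)⁻²θᵀφ(θᵀθ)⁻¹θᵀ` of the operator `L(θ,φ)`. -/
def L1blk {n p : ℕ} (k₁ : ℝ) (θ φ : Matrix (Fin n) (Fin p) ℝ) :
    Matrix (Fin n) (Fin n) ℝ :=
  -((1 / (4 * k₁)) • (θ * ((θᵀ * θ)⁻¹ * (θᵀ * θ)⁻¹) * θᵀ * φ * (θᵀ * θ)⁻¹ * θᵀ))

/-- The block `L₂ = (1/(4k₁))θ(θᵀθ)⁻¹φᵀθ(θᵀθ)⁻²θᵀφ(θᵀθ)⁻¹θᵀ + (1/(2k₂))θ(θᵀθ)⁻²θᵀ`. -/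
def L2blk {n p : ℕ} (k₁ k₂ : ℝ) (θ φ : Matrix (Fin n) (Fin p) ℝ) :
    Matrix (Fin n) (Fin n) ℝ :=
  (1 / (4 * k₁)) • (θ * (θᵀ * θ)⁻¹ * φᵀ * θ * ((θᵀ * θ)⁻¹ * (θᵀ * θ)⁻¹) * θᵀ * φ *
      (θᵀ * θ)⁻¹ * θᵀ) +
    (1 / (2 * k₂)) • (θ * ((θᵀ * θ)⁻¹ * (θᵀ * θ)⁻¹) * θᵀ)

lemma isUnit_det_of_mNorm_lt {p : ℕ} (S : Matrix (Fin p) (Fin p) ℝ)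
    (h : mNorm (S - 1) < 1) : IsUnit S.det := by
  rw [isUnit_iff_ne_zero]
  intro h0
  obtain ⟨v, hv, hSv⟩ := Matrix.exists_mulVec_eq_zero_iff.mpr h0
  have hE : mInner (S - 1) (S - 1) = ∑ i, ∑ j, (S - 1) i j ^ 2 := by
    unfold mInner
    simp only [Matrix.trace, Matrix.diag_apply, Matrix.mul_apply, Matrix.transpose_apply]
    rw [Finset.sum_comm]
    simp only [sq]
  have hlt : mInner (S - 1) (S - 1) < 1 := by
    unfold mNorm at h
    rw [Real.sqrt_lt' one_pos] at h
    simpa using h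
  rw [hE] at hlt
  have hvi : ∀ i, v i = -∑ j, (S - 1) i j * v j := by
    intro i
    have h1 : (S - 1) *ᵥ v = -v := by
      rw [Matrix.sub_mulVec, hSv, Matrix.one_mulVec, zero_sub]
    have h2 := congrFun h1 i
    simp only [Matrix.mulVec, dotProduct, Pi.neg_apply] at h2
    rw [h2, neg_neg]
  have hle : ∀ i, v i ^ 2 ≤ (∑ j, (S - 1) i j ^ 2) * ∑ j, v j ^ 2 := by
    intro i
    have h1 := Finset.sum_mul_sq_le_sq_mul_sq Finset.univ (fun j => (S - 1) i j) v
    rw [hvi i, neg_sq]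
    exact h1
  have hsum : ∑ i, v i ^ 2 ≤ (∑ i, ∑ j, (S - 1) i j ^ 2) * ∑ j, v j ^ 2 := by
    rw [Finset.sum_mul]
    exact Finset.sum_le_sum fun i _ => hle i
  have hpos : 0 < ∑ i, v i ^ 2 := by
    obtain ⟨i, hi⟩ := Function.ne_iff.mp hv
    have hi' : v i ≠ 0 := hi
    exact Finset.sum_pos' (fun i _ => sq_nonneg _) ⟨i, Finset.mem_univ i, by positivity⟩
  nlinarith

/-- on `W`, the feedback term of system (7) equals `α·L(θ,φ)∇V(θ,φ)`. -/
theorem stmt8 (n p : ℕ) (hp : 0 < p) (hpn : p ≤ n)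
    (k₁ k₂ α : ℝ) (hk₁ : 0 < k₁) (hk₂ : 0 < k₂) (hα : 0 < α)
    (θ φ : Matrix (Fin n) (Fin p) ℝ)
    (hW : mNorm (θᵀ * θ - 1) < 1) :
    (α / 4) • (θ * (1 - (θᵀ * θ)⁻¹)) =
      α • (Lblk k₁ θ * (gradV k₁ k₂ (θ, φ)).1 + L1blk k₁ θ φ * (gradV k₁ k₂ (θ, φ)).2) ∧
    (α / 4) • (θ * (θᵀ * θ)⁻¹ * (φᵀ * θ * (θᵀ * θ)⁻¹ + θᵀ * φ)) =
      α • ((L1blk k₁ θ φ)ᵀ * (gradV k₁ k₂ (θ, φ)).1 +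
        L2blk k₁ k₂ θ φ * (gradV k₁ k₂ (θ, φ)).2) := by
  have hu := isUnit_det_of_mNorm_lt _ hW
  have hk₁' := hk₁.ne'
  have hk₂' := hk₂.ne'
  have hGT : ((θᵀ * θ)⁻¹)ᵀ = (θᵀ * θ)⁻¹ := by
    rw [Matrix.transpose_nonsing_inv, Matrix.transpose_mul, Matrix.transpose_transpose]
  have hGS : (θᵀ * θ)⁻¹ * (θᵀ * θ) = 1 := Matrix.nonsing_inv_mul _ hu
  have hMT : (θᵀ * φ)ᵀ = φᵀ * θ := by
    rw [Matrix.transpose_mul, Matrix.transpose_transpose]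
  generalize hG : (θᵀ * θ)⁻¹ = G at *
  have hX : ∀ X : Matrix (Fin p) (Fin p) ℝ, G * (θᵀ * (θ * X)) = X := by
    intro X
    rw [← Matrix.mul_assoc θᵀ, ← Matrix.mul_assoc G, hGS, Matrix.one_mul]
  have hY : symPart (θᵀ * φ) = (1 / 2 : ℝ) • (θᵀ * φ + φᵀ * θ) := by
    rw [symPart, hMT]
  have hA : G * (θᵀ * θ - 1) = 1 - G := by
    rw [Matrix.mul_sub, hGS, Matrix.mul_one]
  have hL1T : (L1blk k₁ θ φ)ᵀ = -((1 / (4 * k₁)) • (θ * (G * (φᵀ * (θ * (G * (G * θᵀ))))))) := by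
    simp only [L1blk, hG, Matrix.transpose_neg, Matrix.transpose_smul, Matrix.transpose_mul,
      Matrix.transpose_transpose, hGT, Matrix.mul_assoc]
  constructor
  · simp only [Lblk, L1blk, gradV, hG]
    generalize symPart (θᵀ * φ) = Y
    simp only [Matrix.mul_add, Matrix.neg_mul, Matrix.smul_mul, Matrix.mul_smul,
      Matrix.mul_assoc, hA, hX]
    match_scalars <;> field_simp <;> ring
  · rw [hL1T]
    simp only [L2blk, gradV, hG]
    have e : θ * (G * symPart (θᵀ * φ)) =
        (1 / 2 : ℝ) • (θ * (G * (θᵀ * φ)) + θ * (G * (φᵀ * θ))) := by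
      rw [hY, Matrix.mul_smul, Matrix.mul_smul, Matrix.mul_add, Matrix.mul_add]
    generalize symPart (θᵀ * φ) = Y at *
    simp only [Matrix.mul_add, Matrix.add_mul, Matrix.neg_mul, Matrix.smul_mul, Matrix.mul_smul,
      Matrix.mul_assoc, hA, hX, e]
    simp only [Matrix.mul_sub, Matrix.mul_one]
    match_scalars <;> field_simp <;> ring
end
end
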